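/- Let λ_1, …, λ_n ∈ [-1,1], let ε ∈ (0,1), and let N be a positive integer divisible by 4 with N ≥ 18/ε. For k = 0,…,N set τ_k = (1/n)·Σ_{i=1}^{n} T̄_k(λ_i), and define q(x) = w(x)·Σ_{k=0}^{N} (b̂_N[k]/b̂_N[0]) · τ_k · T̄_k(x). Then: (i) q(x) ≥ 0 for all x ∈ (−1,1); (ii) ∫_{−1}^{1} q(x) dx = 1; and (iii) for every 1-Lipschitz function f : [-1,1] → ℝ, one has |(1/n)·Σ_{i=1}^{n} f(λ_i) − ∫_{−1}^{1} f(x) q(x) dx| ≤ ε. -/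

import Mathlib

open MeasureTheory

/-- The normalized Chebyshev polynomials of the first kind, as functions on `ℝ`:
`T̄_0 = T_0 / √π` and `T̄_k = √(2/π) · T_k` for `k ≥ 1`. -/
noncomputable def Tbar (k : ℕ) (x : ℝ) : ℝ :=
  if k = 0 then ((Polynomial.Chebyshev.T ℝ 0).eval x) / Real.sqrt Real.pi
  else Real.sqrt (2 / Real.pi) * ((Polynomial.Chebyshev.T ℝ (k : ℤ)).eval x)

/-- The Chebyshev weight function `w(x) = 1/√(1 - x²)`. -/
noncomputable def wCheb (x : ℝ) : ℝ := 1 / Real.sqrt (1 - x ^ 2)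

/-- The Jackson coefficients
`b̂_N[k] = Σ_{j = -N/2-1}^{N/2+1-k} (N/2+1-|j|)·(N/2+1-|j+k|)`. -/
noncomputable def bhat (N k : ℕ) : ℝ :=
  ∑ j ∈ Finset.Icc (-(N : ℤ) / 2 - 1) ((N : ℤ) / 2 + 1 - (k : ℤ)),
    ((((N : ℤ) / 2 + 1 - |j|) * ((N : ℤ) / 2 + 1 - |j + (k : ℤ)|) : ℤ) : ℝ)

/-- The `k`-th normalized Chebyshev moment `τ_k = (1/n)·Σ_i T̄_k(λ_i)` of the
spectral density of eigenvalues `λ_1, …, λ_n`. -/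
noncomputable def chebMoment (n : ℕ) (lam : Fin n → ℝ) (k : ℕ) : ℝ :=
  (1 / (n : ℝ)) * ∑ i, Tbar k (lam i)

/-- The density returned by the idealized Jackson damped kernel polynomial method:
`q(x) = w(x)·Σ_{k=0}^N (b̂_N[k]/b̂_N[0]) · τ_k · T̄_k(x)`. -/
noncomputable def kpmDensity (n : ℕ) (lam : Fin n → ℝ) (N : ℕ) (x : ℝ) : ℝ :=
  wCheb x * ∑ k ∈ Finset.range (N + 1),
    (bhat N k / bhat N 0) * chebMoment n lam k * Tbar k x


open Polynomial.Chebyshev in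
/-- The kernel centred at `y`. -/
noncomputable def pker (N : ℕ) (y x : ℝ) : ℝ :=
  ∑ k ∈ Finset.range (N + 1), (bhat N k / bhat N 0) * Tbar k y * Tbar k x

theorem sum_Icc_int (F : ℤ → ℝ) (p q : ℤ) (r : ℕ) (h : q + 1 - p = r) :
    ∑ j ∈ Finset.Icc p q, F j = ∑ i ∈ Finset.range r, F (p + i) := by
  symm
  refine Finset.sum_nbij' (fun i : ℕ => p + (i : ℤ)) (fun j : ℤ => (j - p).toNat) ?_ ?_ ?_ ?_ ?_
  · intro i hi
    simp only [Finset.mem_range, Finset.mem_Icc] at *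
    omega
  · intro i hi
    simp only [Finset.mem_range, Finset.mem_Icc] at *
    omega
  · intro i hi
    simp
  · intro i hi
    simp only [Finset.mem_Icc] at *
    omega
  · intro i hi
    rfl

theorem sum_quad (α β γ : ℝ) (r : ℕ) :
    ∑ i ∈ Finset.range r, (α + β * (i : ℝ) + γ * (i : ℝ) ^ 2) =
      α * r + β * (r * (r - 1) / 2) + γ * (r * (r - 1) * (2 * r - 1) / 6) := by
  induction r with
  | zero => simp
  | succ r ih => rw [Finset.sum_range_succ, ih]; push_cast; ring

theorem bhat_eq (h k : ℕ) : bhat (2 * h) k =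
    ∑ j ∈ Finset.Icc (-((h : ℤ) + 1)) ((h : ℤ) + 1 - k),
      ((((h : ℤ) + 1 - |j|) * ((h : ℤ) + 1 - |j + (k : ℤ)|) : ℤ) : ℝ) := by
  unfold bhat
  have h1 : -((2 * h : ℕ) : ℤ) / 2 - 1 = -((h : ℤ) + 1) := by push_cast; omega
  have h2 : ((2 * h : ℕ) : ℤ) / 2 = h := by push_cast; omega
  rw [h1, h2]

theorem bhat_zero (h : ℕ) : bhat (2 * h) 0 = (h + 1) * (2 * (h + 1 : ℝ) ^ 2 + 1) / 3 := by
  rw [bhat_eq, sum_Icc_int _ _ _ ((h + 1) + (h + 2)) (by push_cast; ring), Finset.sum_range_add]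
  have e1 : ∀ i ∈ Finset.range (h + 1),
      ((((h : ℤ) + 1 - |-((h : ℤ) + 1) + (i : ℤ)|) *
        ((h : ℤ) + 1 - |-((h : ℤ) + 1) + (i : ℤ) + ((0 : ℕ) : ℤ)|) : ℤ) : ℝ)
      = 0 + 0 * (i : ℝ) + 1 * (i : ℝ) ^ 2 := by
    intro i hi
    rw [Finset.mem_range] at hi
    rw [abs_of_nonpos (by omega), abs_of_nonpos (by omega)]
    push_cast; ring
  have e2 : ∀ i ∈ Finset.range (h + 2),
      ((((h : ℤ) + 1 - |-((h : ℤ) + 1) + ((h + 1 + i : ℕ) : ℤ)|) *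
        ((h : ℤ) + 1 - |-((h : ℤ) + 1) + ((h + 1 + i : ℕ) : ℤ) + ((0 : ℕ) : ℤ)|) : ℤ) : ℝ)
      = (h + 1 : ℝ) ^ 2 + (-2 * (h + 1 : ℝ)) * (i : ℝ) + 1 * (i : ℝ) ^ 2 := by
    intro i hi
    rw [Finset.mem_range] at hi
    rw [abs_of_nonneg (by omega), abs_of_nonneg (by omega)]
    push_cast; ring
  rw [Finset.sum_congr rfl e1, Finset.sum_congr rfl e2, sum_quad, sum_quad]
  push_cast; ring

theorem bhat_one (h : ℕ) : bhat (2 * h) 1 = bhat (2 * h) 0 - (h + 1) := by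
  rw [bhat_zero, bhat_eq, sum_Icc_int _ _ _ ((h + 1) + (h + 1)) (by push_cast; ring),
    Finset.sum_range_add]
  have e1 : ∀ i ∈ Finset.range (h + 1),
      ((((h : ℤ) + 1 - |-((h : ℤ) + 1) + (i : ℤ)|) *
        ((h : ℤ) + 1 - |-((h : ℤ) + 1) + (i : ℤ) + ((1 : ℕ) : ℤ)|) : ℤ) : ℝ)
      = 0 + 1 * (i : ℝ) + 1 * (i : ℝ) ^ 2 := by
    intro i hi
    rw [Finset.mem_range] at hi
    rw [abs_of_nonpos (by omega), abs_of_nonpos (by omega)]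
    push_cast; ring
  have e2 : ∀ i ∈ Finset.range (h + 1),
      ((((h : ℤ) + 1 - |-((h : ℤ) + 1) + ((h + 1 + i : ℕ) : ℤ)|) *
        ((h : ℤ) + 1 - |-((h : ℤ) + 1) + ((h + 1 + i : ℕ) : ℤ) + ((1 : ℕ) : ℤ)|) : ℤ) : ℝ)
      = (h + 1 : ℝ) * h + (-2 * h - 1 : ℝ) * (i : ℝ) + 1 * (i : ℝ) ^ 2 := by
    intro i hi
    rw [Finset.mem_range] at hi
    rw [abs_of_nonneg (by omega), abs_of_nonneg (by omega)]
    push_cast; ring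
  rw [Finset.sum_congr rfl e1, Finset.sum_congr rfl e2, sum_quad, sum_quad]
  push_cast; ring

theorem bhat_two (h : ℕ) : bhat (2 * h) 2 = bhat (2 * h) 0 - (4 * h + 1) := by
  rw [bhat_zero, bhat_eq, sum_Icc_int _ _ _ (h + 1 + h) (by push_cast; ring),
    Finset.sum_range_add, Finset.sum_range_succ]
  have e1 : ∀ i ∈ Finset.range h,
      ((((h : ℤ) + 1 - |-((h : ℤ) + 1) + (i : ℤ)|) *
        ((h : ℤ) + 1 - |-((h : ℤ) + 1) + (i : ℤ) + ((2 : ℕ) : ℤ)|) : ℤ) : ℝ)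
      = 0 + 2 * (i : ℝ) + 1 * (i : ℝ) ^ 2 := by
    intro i hi
    rw [Finset.mem_range] at hi
    rw [abs_of_nonpos (by omega), abs_of_nonpos (by omega)]
    push_cast; ring
  have e2 : ∀ i ∈ Finset.range h,
      ((((h : ℤ) + 1 - |-((h : ℤ) + 1) + ((h + 1 + i : ℕ) : ℤ)|) *
        ((h : ℤ) + 1 - |-((h : ℤ) + 1) + ((h + 1 + i : ℕ) : ℤ) + ((2 : ℕ) : ℤ)|) : ℤ) : ℝ)
      = (h + 1 : ℝ) * (h - 1) + (-2 * h : ℝ) * (i : ℝ) + 1 * (i : ℝ) ^ 2 := by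
    intro i hi
    rw [Finset.mem_range] at hi
    rw [abs_of_nonneg (by omega), abs_of_nonneg (by omega)]
    push_cast; ring
  rw [Finset.sum_congr rfl e1, Finset.sum_congr rfl e2, sum_quad, sum_quad]
  have e3 : |-((h : ℤ) + 1) + (h : ℤ)| = 1 := by rw [abs_of_nonpos] <;> omega
  have e4 : |-((h : ℤ) + 1) + (h : ℤ) + ((2 : ℕ) : ℤ)| = 1 := by
    rw [abs_of_nonneg] <;> push_cast <;> omega
  rw [e3, e4]
  push_cast; ring

theorem bhat_zero_pos (h : ℕ) : 0 < bhat (2 * h) 0 := by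
  rw [bhat_zero]; positivity

/-- Fejer-Riesz: the symmetric double sum regrouped. -/
theorem bhat_cos_sum (h : ℕ) (t : ℝ) :
    0 ≤ bhat (2 * h) 0 + 2 * ∑ k ∈ Finset.Icc 1 (2 * h), bhat (2 * h) k * Real.cos (k * t) := by
  set s : Finset ℤ := Finset.Icc (-((h : ℤ) + 1)) ((h : ℤ) + 1) with hs
  set a : ℤ → ℝ := fun j => (((h : ℤ) + 1 - |j| : ℤ) : ℝ) with ha
  set g : ℤ → ℤ → ℝ := fun j l => a j * a l * Real.cos (((l : ℝ) - j) * t) with hg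
  have gsymm : ∀ j l, g j l = g l j := by
    intro j l
    simp only [hg]
    rw [← Real.cos_neg]
    ring_nf
  have pos : 0 ≤ ∑ p ∈ s ×ˢ s, g p.1 p.2 := by
    have : ∑ p ∈ s ×ˢ s, g p.1 p.2 =
        (∑ j ∈ s, a j * Real.cos (j * t)) ^ 2 + (∑ j ∈ s, a j * Real.sin (j * t)) ^ 2 := by
      rw [Finset.sum_product, sq, sq, Finset.sum_mul_sum, Finset.sum_mul_sum,
        ← Finset.sum_add_distrib]
      refine Finset.sum_congr rfl fun j _ => ?_
      rw [← Finset.sum_add_distrib]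
      refine Finset.sum_congr rfl fun l _ => ?_
      simp only [hg]
      rw [sub_mul, Real.cos_sub]; ring
    rw [this]; positivity
  have split : ∑ p ∈ s ×ˢ s, g p.1 p.2 = ∑ j ∈ s, g j j +
      2 * ∑ p ∈ (s ×ˢ s).filter (fun p => p.1 < p.2), g p.1 p.2 := by
    have h1 := Finset.sum_filter_add_sum_filter_not (s ×ˢ s) (fun p : ℤ × ℤ => p.1 < p.2)
      (fun p => g p.1 p.2)
    have h2 := Finset.sum_filter_add_sum_filter_not
      ((s ×ˢ s).filter (fun p : ℤ × ℤ => ¬ p.1 < p.2)) (fun p : ℤ × ℤ => p.2 < p.1)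
      (fun p => g p.1 p.2)
    have h3 : ∑ p ∈ ((s ×ˢ s).filter (fun p : ℤ × ℤ => ¬ p.1 < p.2)).filter
        (fun p : ℤ × ℤ => p.2 < p.1), g p.1 p.2 =
        ∑ p ∈ (s ×ˢ s).filter (fun p => p.1 < p.2), g p.1 p.2 := by
      refine Finset.sum_nbij' Prod.swap Prod.swap ?_ ?_ ?_ ?_ ?_
      · rintro ⟨x, y⟩ hp
        simp only [Finset.mem_filter, Finset.mem_product, Prod.swap] at *
        tauto
      · rintro ⟨x, y⟩ hp
        simp only [Finset.mem_filter, Finset.mem_product, Prod.swap] at *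
        refine ⟨⟨⟨hp.1.2, hp.1.1⟩, by omega⟩, hp.2⟩
      · intro p _; simp
      · intro p _; simp
      · rintro ⟨x, y⟩ hp
        exact gsymm _ _
    have h4 : ∑ p ∈ ((s ×ˢ s).filter (fun p : ℤ × ℤ => ¬ p.1 < p.2)).filter
        (fun p : ℤ × ℤ => ¬ p.2 < p.1), g p.1 p.2 = ∑ j ∈ s, g j j := by
      symm
      refine Finset.sum_nbij' (fun j => (j, j)) Prod.fst ?_ ?_ ?_ ?_ ?_
      · intro j hj
        simp [hj]
      · rintro ⟨x, y⟩ hp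
        simp only [Finset.mem_filter, Finset.mem_product] at *
        tauto
      · intro j _; rfl
      · rintro ⟨x, y⟩ hp
        simp only [Finset.mem_filter, Finset.mem_product] at *
        have : x = y := by omega
        simp [this]
      · intro j _; rfl
    linarith
  have diag : ∑ j ∈ s, g j j = bhat (2 * h) 0 := by
    rw [bhat_eq]
    simp [hg, ha, hs]
  have upper : ∑ p ∈ (s ×ˢ s).filter (fun p => p.1 < p.2), g p.1 p.2 =
      ∑ k ∈ Finset.Icc 1 (2 * h), bhat (2 * h) k * Real.cos (k * t) := by
    have e : ∀ k ∈ Finset.Icc 1 (2 * h), bhat (2 * h) k * Real.cos (k * t) =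
        ∑ j ∈ Finset.Icc (-((h : ℤ) + 1)) ((h : ℤ) + 1 - k), g j (j + k) := by
      intro k _
      rw [bhat_eq, Finset.sum_mul]
      refine Finset.sum_congr rfl fun j _ => ?_
      simp only [hg, ha]
      push_cast
      congr 2
      ring
    rw [Finset.sum_congr rfl e, Finset.sum_sigma']
    symm
    refine Finset.sum_bij_ne_zero (fun x _ _ => (x.2, x.2 + (x.1 : ℤ))) ?_ ?_ ?_ ?_
    · rintro ⟨k, j⟩ hp _
      simp only [Finset.mem_sigma, Finset.mem_filter, Finset.mem_product, Finset.mem_Icc, hs] at *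
      omega
    · rintro ⟨k, j⟩ hp _ ⟨k', j'⟩ hp' _ heq
      simp only [Prod.mk.injEq] at heq
      obtain ⟨h1, h2⟩ := heq
      subst h1
      have : k = k' := by omega
      subst this
      rfl
    · rintro ⟨x, y⟩ hp hne
      simp only [Finset.mem_filter, Finset.mem_product, Finset.mem_Icc, hs] at hp
      have hx : x ≠ -((h : ℤ) + 1) := by
        rintro rfl
        apply hne
        simp only [hg, ha]
        rw [abs_of_nonpos (by omega)]
        simp
      have hy : y ≠ (h : ℤ) + 1 := by
        rintro rfl
        apply hne
        simp only [hg, ha]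
        rw [abs_of_nonneg (a := (h : ℤ) + 1) (by omega)]
        simp
      have hxy : x + (((y - x).toNat : ℕ) : ℤ) = y := by omega
      refine ⟨⟨(y - x).toNat, x⟩, ?_, ?_, ?_⟩
      · simp only [Finset.mem_sigma, Finset.mem_Icc]
        omega
      · simp only [hxy]
        exact hne
      · simp only [hxy]
    · rintro ⟨k, j⟩ hp _
      rfl
  rw [← diag, ← upper, ← split]
  exact pos

theorem Tbar_zero (x : ℝ) : Tbar 0 x = 1 / √Real.pi := by simp [Tbar]

theorem Tbar_pos {k : ℕ} (hk : k ≠ 0) (x : ℝ) :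
    Tbar k x = √(2 / Real.pi) * (Polynomial.Chebyshev.T ℝ (k : ℤ)).eval x := by simp [Tbar, hk]

theorem Tbar_cont (k : ℕ) : Continuous (Tbar k) := by
  unfold Tbar
  split_ifs <;> fun_prop

theorem pker_cont (N : ℕ) (y : ℝ) : Continuous (pker N y) := by
  unfold pker
  have := Tbar_cont
  fun_prop

theorem pker_nonneg (h : ℕ) {x y : ℝ} (hx : x ∈ Set.Icc (-1 : ℝ) 1) (hy : y ∈ Set.Icc (-1 : ℝ) 1) :
    0 ≤ pker (2 * h) y x := by
  have b0 := bhat_zero_pos h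
  obtain ⟨θ, rfl⟩ : ∃ θ, x = Real.cos θ := ⟨Real.arccos x, (Real.cos_arccos hx.1 hx.2).symm⟩
  obtain ⟨φ, rfl⟩ : ∃ θ, y = Real.cos θ := ⟨Real.arccos y, (Real.cos_arccos hy.1 hy.2).symm⟩
  have key : pker (2 * h) (Real.cos φ) (Real.cos θ) = 1 / (2 * Real.pi * bhat (2 * h) 0) *
     ((bhat (2 * h) 0 + 2 * ∑ k ∈ Finset.Icc 1 (2 * h), bhat (2 * h) k * Real.cos (k * (φ - θ))) +
     (bhat (2 * h) 0 + 2 * ∑ k ∈ Finset.Icc 1 (2 * h), bhat (2 * h) k * Real.cos (k * (φ + θ)))) := by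
    unfold pker
    rw [Finset.sum_range_eq_add_Ico _ (by omega)]
    have hI : Finset.Ico 1 (2 * h + 1) = Finset.Icc 1 (2 * h) := by ext k; simp only [Finset.mem_Ico, Finset.mem_Icc]; omega
    rw [hI]
    have e : ∀ k ∈ Finset.Icc 1 (2 * h), bhat (2 * h) k / bhat (2 * h) 0 * Tbar k (Real.cos φ) *
        Tbar k (Real.cos θ) = 1 / (2 * Real.pi * bhat (2 * h) 0) * (2 *
          (bhat (2 * h) k * Real.cos (k * (φ - θ)) + bhat (2 * h) k * Real.cos (k * (φ + θ)))) := by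
      intro k hk
      have hk0 : k ≠ 0 := by simp at hk; omega
      rw [Tbar_pos hk0, Tbar_pos hk0, Polynomial.Chebyshev.T_real_cos,
        Polynomial.Chebyshev.T_real_cos, mul_sub (k : ℝ), mul_add (k : ℝ), Real.cos_sub, Real.cos_add]
      have hs : √(2 / Real.pi) * √(2 / Real.pi) = 2 / Real.pi :=
        Real.mul_self_sqrt (by positivity)
      push_cast
      calc _ = bhat (2 * h) k / bhat (2 * h) 0 * (√(2 / Real.pi) * √(2 / Real.pi)) *
            (Real.cos (k * φ) * Real.cos (k * θ)) := by ring
        _ = _ := by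
          rw [hs]; field_simp; ring
    rw [Finset.sum_congr rfl e, ← Finset.mul_sum, ← Finset.mul_sum, Finset.sum_add_distrib,
      Tbar_zero, Tbar_zero]
    have hs : √Real.pi * √Real.pi = Real.pi := Real.mul_self_sqrt (by positivity)
    have : bhat (2 * h) 0 / bhat (2 * h) 0 * (1 / √Real.pi) * (1 / √Real.pi) =
        1 / (2 * Real.pi * bhat (2 * h) 0) * (bhat (2 * h) 0 + bhat (2 * h) 0) := by
      rw [div_self b0.ne', one_mul, one_div_mul_one_div, hs]
      field_simp; ring
    rw [this]; ring
  rw [key]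
  have h1 := bhat_cos_sum h (φ - θ)
  have h2 := bhat_cos_sum h (φ + θ)
  have hpi := Real.pi_pos
  exact mul_nonneg (one_div_nonneg.2 (mul_nonneg (by positivity) b0.le)) (add_nonneg h1 h2)

open Polynomial.Chebyshev in
theorem Tbar_orth (j k : ℕ) : ∫ x, Tbar j x * Tbar k x ∂measureT = if j = k then 1 else 0 := by
  have hs : √(2 / Real.pi) * √(2 / Real.pi) = 2 / Real.pi :=
    Real.mul_self_sqrt (by positivity)
  have hs' : √Real.pi * √Real.pi = Real.pi := Real.mul_self_sqrt (by positivity)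
  have hpi := Real.pi_pos
  have gen : ∀ k : ℕ, ∃ c : ℝ, (∀ x, Tbar k x = c * (T ℝ (k : ℤ)).eval x) ∧
      c * c = if k = 0 then 1 / Real.pi else 2 / Real.pi := by
    intro k
    by_cases hk : k = 0
    · refine ⟨1 / √Real.pi, ?_, ?_⟩
      · intro x; subst hk; simp [Tbar_zero]
      · rw [if_pos hk, one_div_mul_one_div, hs']
    · exact ⟨_, Tbar_pos hk, by rw [if_neg hk, hs]⟩
  obtain ⟨c, hc, hc2⟩ := gen j
  obtain ⟨d, hd, hd2⟩ := gen k
  by_cases hjk : j = k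
  · subst hjk
    simp_rw [hc]
    have : ∀ x : ℝ, c * (T ℝ (j : ℤ)).eval x * (c * (T ℝ (j : ℤ)).eval x) =
      (c * c) * ((T ℝ (j : ℤ)).eval x * (T ℝ (j : ℤ)).eval x) := by intro x; ring
    simp_rw [this]
    rw [integral_const_mul, hc2, if_pos trivial]
    by_cases hj : j = 0
    · subst hj
      have := integral_eval_T_real_mul_self_measureT_zero
      simp only [Nat.cast_zero, if_true]
      rw [this]; field_simp
    · rw [integral_T_real_mul_self_measureT_of_ne_zero hj, if_neg hj]; field_simp
  · simp_rw [hc, hd]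
    have : ∀ x : ℝ, c * (T ℝ (j : ℤ)).eval x * (d * (T ℝ (k : ℤ)).eval x) =
      (c * d) * ((T ℝ (j : ℤ)).eval x * (T ℝ (k : ℤ)).eval x) := by intro x; ring
    simp_rw [this]
    rw [integral_const_mul, integral_eval_T_real_mul_eval_T_real_measureT_of_ne hjk, if_neg hjk,
      mul_zero]

open Polynomial.Chebyshev in
theorem Tbar_pker (N j : ℕ) (hj : j ≤ N) (y : ℝ) :
    ∫ x, Tbar j x * pker N y x ∂measureT = bhat N j / bhat N 0 * Tbar j y := by
  unfold pker
  simp_rw [Finset.mul_sum]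
  have hT := Tbar_cont
  rw [integral_finsetSum _ (fun k _ => integrable_measureT (by fun_prop))]
  have : ∀ k ∈ Finset.range (N + 1), ∫ x, Tbar j x * (bhat N k / bhat N 0 * Tbar k y * Tbar k x)
      ∂measureT = if j = k then bhat N k / bhat N 0 * Tbar k y else 0 := by
    intro k _
    have e : ∀ x, Tbar j x * (bhat N k / bhat N 0 * Tbar k y * Tbar k x) =
      (bhat N k / bhat N 0 * Tbar k y) * (Tbar j x * Tbar k x) := by intro x; ring
    simp_rw [e]
    rw [integral_const_mul, Tbar_orth]
    simp
  rw [Finset.sum_congr rfl this, Finset.sum_ite_eq, if_pos (by simp; omega)]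

open Polynomial.Chebyshev in
theorem pker_T (h j : ℕ) (hj : j ≤ 2 * h) (y : ℝ) :
    ∫ x, (T ℝ (j : ℤ)).eval x * pker (2 * h) y x ∂measureT =
      bhat (2 * h) j / bhat (2 * h) 0 * (T ℝ (j : ℤ)).eval y := by
  have hpi := Real.pi_pos
  have gen : ∃ c : ℝ, (∀ x, Tbar j x = c * (T ℝ (j : ℤ)).eval x) ∧ c ≠ 0 := by
    by_cases hk : j = 0
    · refine ⟨1 / √Real.pi, ?_, by positivity⟩
      intro x; subst hk; simp [Tbar_zero]
    · exact ⟨_, Tbar_pos hk, by positivity⟩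
  obtain ⟨c, hc, hc0⟩ := gen
  have := Tbar_pker (2 * h) j hj y
  simp_rw [hc, mul_assoc] at this
  rw [integral_const_mul] at this
  apply mul_left_cancel₀ hc0
  rw [this]; ring

open Polynomial.Chebyshev in
theorem pker_mass (h : ℕ) (y : ℝ) : ∫ x, pker (2 * h) y x ∂measureT = 1 := by
  have := pker_T h 0 (by omega) y
  simpa [(bhat_zero_pos h).ne'] using this

open Polynomial.Chebyshev in
theorem pker_var (h : ℕ) (hh : 2 ≤ h) {y : ℝ} :
    ∫ x, (y - x) ^ 2 * pker (2 * h) y x ∂measureT ≤ 3 / ((h : ℝ) + 1) ^ 2 := by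
  have m0 := pker_mass h y
  have m1 := pker_T h 1 (by omega) y
  have m2 := pker_T h 2 (by omega) y
  have hp := pker_cont (2 * h) y
  have e : ∀ x, (y - x) ^ 2 * pker (2 * h) y x = (y ^ 2 + 1 / 2) * pker (2 * h) y x +
      ((-2 * y) * ((T ℝ ((1 : ℕ) : ℤ)).eval x * pker (2 * h) y x) +
       (1 / 2) * ((T ℝ ((2 : ℕ) : ℤ)).eval x * pker (2 * h) y x)) := by
    intro x
    simp [T_two]
    ring
  simp_rw [e]
  rw [integral_add (integrable_measureT (by fun_prop)) (integrable_measureT (by fun_prop)),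
    integral_add (integrable_measureT (by fun_prop)) (integrable_measureT (by fun_prop)),
    integral_const_mul, integral_const_mul, integral_const_mul, m0, m1, m2]
  rw [bhat_one, bhat_two, sub_div, sub_div, div_self (bhat_zero_pos h).ne', bhat_zero]
  simp only [Nat.cast_one, Nat.cast_ofNat, T_one, T_two, Polynomial.eval_X, Polynomial.eval_sub,
    Polynomial.eval_mul, Polynomial.eval_pow, Polynomial.eval_one, Polynomial.eval_ofNat]
  have hh' : (2 : ℝ) ≤ h := by exact_mod_cast hh
  generalize (h : ℝ) = m at hh' ⊢
  have : (y ^ 2 + 1 / 2) * 1 + (-2 * y * ((1 - (m + 1) / ((m + 1) * (2 * (m + 1) ^ 2 + 1) / 3)) * y)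
      + 1 / 2 * ((1 - (4 * m + 1) / ((m + 1) * (2 * (m + 1) ^ 2 + 1) / 3)) * (2 * y ^ 2 - 1)))
      = (3 * (4 * m + 1) / 2 - y ^ 2 * (6 * m - 3)) / ((m + 1) * (2 * (m + 1) ^ 2 + 1)) := by
    field_simp
    ring
  rw [this, div_le_div_iff₀ (by positivity) (by positivity)]
  have h1 : 0 ≤ y ^ 2 * (6 * m - 3) := mul_nonneg (by positivity) (by linarith)
  have h2 : 3 * (4 * m + 1) / 2 - y ^ 2 * (6 * m - 3) ≤ 6 * (m + 1) := by linarith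
  have h3 := mul_le_mul_of_nonneg_right h2 (show 0 ≤ (m + 1) ^ 2 by positivity)
  nlinarith

open Polynomial.Chebyshev in
theorem pker_lip (h : ℕ) (hh : 2 ≤ h) {y : ℝ} (hy : y ∈ Set.Icc (-1 : ℝ) 1) {ε : ℝ} (hε : 0 < ε)
    (hhε : 3 / ((h : ℝ) + 1) ^ 2 ≤ ε ^ 2) (f : ℝ → ℝ) (hfc : ContinuousOn f (Set.Icc (-1 : ℝ) 1))
    (hf : ∀ x ∈ Set.Icc (-1 : ℝ) 1, ∀ y ∈ Set.Icc (-1 : ℝ) 1, |f x - f y| ≤ |x - y|) :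
    |f y - ∫ x, f x * pker (2 * h) y x ∂measureT| ≤ ε := by
  have hp := pker_cont (2 * h) y
  have hpc : ContinuousOn (pker (2 * h) y) (Set.Icc (-1) 1) := hp.continuousOn
  have m0 := pker_mass h y
  have e1 : f y - ∫ x, f x * pker (2 * h) y x ∂measureT =
      ∫ x, (f y - f x) * pker (2 * h) y x ∂measureT := by
    simp_rw [sub_mul]
    rw [integral_sub (integrable_measureT (by fun_prop)) (integrable_measureT (by fun_prop)),
      integral_const_mul, m0, mul_one]
  rw [e1, ← Real.norm_eq_abs]
  have mem : ∀ᵐ x ∂measureT, x ∈ Set.Icc (-1 : ℝ) 1 := by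
    unfold measureT
    filter_upwards [ae_restrict_mem measurableSet_Ioc] with x hx
    exact ⟨hx.1.le, hx.2⟩
  have bd : ‖∫ x, (f y - f x) * pker (2 * h) y x ∂measureT‖ ≤
      ∫ x, (1 / (2 * ε) * ((y - x) ^ 2 * pker (2 * h) y x) + ε / 2 * pker (2 * h) y x)
        ∂measureT := by
    apply norm_integral_le_of_norm_le (integrable_measureT (by fun_prop))
    filter_upwards [mem] with x hx
    have hpos := pker_nonneg h hx hy
    rw [norm_mul, Real.norm_eq_abs, Real.norm_eq_abs, abs_of_nonneg hpos, ← mul_assoc, ← add_mul]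
    refine mul_le_mul_of_nonneg_right ((hf y hy x hx).trans ?_) hpos
    rw [← sq_abs (y - x)]
    have : 1 / (2 * ε) * |y - x| ^ 2 + ε / 2 - |y - x| = (|y - x| - ε) ^ 2 / (2 * ε) := by
      field_simp; ring
    have h2 : 0 ≤ (|y - x| - ε) ^ 2 / (2 * ε) := by positivity
    linarith
  refine bd.trans ?_
  rw [integral_add (integrable_measureT (by fun_prop)) (integrable_measureT (by fun_prop)),
    integral_const_mul, integral_const_mul, m0]
  have hv := (pker_var h hh (y := y)).trans hhε
  have := mul_le_mul_of_nonneg_left hv (show 0 ≤ 1 / (2 * ε) by positivity)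
  have e3 : 1 / (2 * ε) * ε ^ 2 = ε / 2 := by field_simp
  linarith

theorem kpm_eq (n : ℕ) (lam : Fin n → ℝ) (N : ℕ) (x : ℝ) :
    kpmDensity n lam N x = wCheb x * ((1 / (n : ℝ)) * ∑ i, pker N (lam i) x) := by
  unfold kpmDensity pker chebMoment
  congr 1
  rw [Finset.sum_comm, Finset.mul_sum]
  refine Finset.sum_congr rfl fun k _ => ?_
  rw [Finset.mul_sum, Finset.mul_sum, Finset.mul_sum, Finset.sum_mul]
  refine Finset.sum_congr rfl fun i _ => ?_
  ring

open Polynomial.Chebyshev in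
theorem kpm_integral (n : ℕ) (lam : Fin n → ℝ) (N : ℕ) (f : ℝ → ℝ)
    (hfc : ContinuousOn f (Set.Icc (-1 : ℝ) 1)) :
    ∫ x in (-1 : ℝ)..1, f x * kpmDensity n lam N x =
      (1 / (n : ℝ)) * ∑ i, ∫ x, f x * pker N (lam i) x ∂measureT := by
  have hpc : ∀ y, ContinuousOn (pker N y) (Set.Icc (-1) 1) := fun y => (pker_cont N y).continuousOn
  rw [← integral_finsetSum _ (fun i _ => integrable_measureT (f := fun x => f x * pker N (lam i) x) (hfc.mul (hpc _))),
    ← integral_const_mul, integral_measureT]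
  congr 1
  ext x
  rw [kpm_eq, wCheb, Real.sqrt_inv, one_div, ← Finset.mul_sum]
  ring

/-- **Guarantee for the idealized Jackson damped kernel polynomial method.**
If `N` is a positive multiple of `4` with `N ≥ 18/ε`, then `q = kpmDensity n lam N` is
a probability density on `[-1,1]` whose Wasserstein-1 distance to the spectral density
`s = (1/n)·Σ_i δ(x - λ_i)` is at most `ε`, in the dual (Kantorovich–Rubinstein)
formulation. -/
theorem idealized_kpm_guarantee (n : ℕ) (hn : 0 < n)
    (lam : Fin n → ℝ) (hlam : ∀ i, lam i ∈ Set.Icc (-1 : ℝ) 1)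
    (ε : ℝ) (hε : ε ∈ Set.Ioo (0 : ℝ) 1)
    (N : ℕ) (hNpos : 0 < N) (hN4 : 4 ∣ N) (hNε : 18 / ε ≤ (N : ℝ)) :
    (∀ x ∈ Set.Ioo (-1 : ℝ) 1, 0 ≤ kpmDensity n lam N x) ∧
    (∫ x in (-1 : ℝ)..1, kpmDensity n lam N x) = 1 ∧
    ∀ f : ℝ → ℝ,
      (∀ x ∈ Set.Icc (-1 : ℝ) 1, ∀ y ∈ Set.Icc (-1 : ℝ) 1, |f x - f y| ≤ |x - y|) →
      |(1 / (n : ℝ)) * ∑ i, f (lam i) - ∫ x in (-1 : ℝ)..1, f x * kpmDensity n lam N x|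
        ≤ ε := by
  obtain ⟨d, rfl⟩ := hN4
  obtain ⟨hε0, hε1⟩ := hε
  have hd : 1 ≤ d := by omega
  obtain ⟨h, hh, hhd⟩ : ∃ h, 4 * d = 2 * h ∧ 2 ≤ h := ⟨2 * d, by ring, by omega⟩
  rw [hh] at hNε ⊢
  have hn' : (0 : ℝ) < n := by exact_mod_cast hn
  have hb : 3 / ((h : ℝ) + 1) ^ 2 ≤ ε ^ 2 := by
    rw [div_le_iff₀ (by positivity), ← mul_pow]
    rw [div_le_iff₀ hε0] at hNε
    push_cast at hNε
    have : 9 ≤ ε * ((h : ℝ) + 1) := by nlinarith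
    nlinarith
  refine ⟨?_, ?_, ?_⟩
  · intro x hx
    rw [kpm_eq]
    have : 0 ≤ ∑ i, pker (2 * h) (lam i) x :=
      Finset.sum_nonneg fun i _ => pker_nonneg h ⟨hx.1.le, hx.2.le⟩ (hlam i)
    unfold wCheb
    positivity
  · have := kpm_integral n lam (2 * h) (fun _ => 1) continuousOn_const
    simp only [one_mul, pker_mass] at this
    rw [this]
    simp [hn'.ne']
  · intro f hf
    have hfc : ContinuousOn f (Set.Icc (-1 : ℝ) 1) := by
      have : LipschitzOnWith 1 f (Set.Icc (-1 : ℝ) 1) := by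
        apply LipschitzOnWith.of_dist_le_mul
        intro x hx y hy
        simpa [Real.dist_eq] using hf x hx y hy
      exact this.continuousOn
    rw [kpm_integral n lam (2 * h) f hfc, ← mul_sub, ← Finset.sum_sub_distrib, abs_mul,
      abs_of_nonneg (by positivity)]
    have hsum : |∑ i, (f (lam i) - ∫ x, f x * pker (2 * h) (lam i) x
        ∂Polynomial.Chebyshev.measureT)| ≤ n * ε := by
      refine (Finset.abs_sum_le_sum_abs _ _).trans ?_
      refine (Finset.sum_le_sum fun i _ => pker_lip h hhd (hlam i) hε0 hb f hfc hf).trans ?_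
      simp
    calc _ ≤ 1 / (n : ℝ) * (n * ε) := mul_le_mul_of_nonneg_left hsum (by positivity)
      _ = ε := by field_simp
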